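/- For all natural numbers a, b, let G^{(a,b)}(x,y) := Σ_T a^{LO(T)} b^{RO(T)} x^{|LV(T)|} y^{|RV(T)|}/(|LV(T)|! |RV(T)|!) in ℚ[[x,y]], the sum running over all non-ambiguous trees T of nonempty shape. Then G^{(a,b)} · (1 − (e^x − 1)(e^y − 1))^{a+b} = e^{ax + by}, where e^x, e^y, e^{ax+by} denote formal exponential power series. -/

import Mathlib

inductive BT : Type where
  | nil : BT
  | node : BT → BT → BT
  deriving DecidableEq

namespace BT

/-- The list of positions (paths from the root, `false` = left step, `true` = right step)
of the vertices of a binary tree. -/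
def paths : BT → List (List Bool)
  | .nil => []
  | .node l r => [] :: (l.paths.map (List.cons false) ++ r.paths.map (List.cons true))

/-- Number of vertices. -/
def size (B : BT) : ℕ := B.paths.length

/-- The set of left children (positions ending with a left step). -/
def leftVertices (B : BT) : Finset (List Bool) :=
  B.paths.toFinset.filter (fun p => p.getLast? = some false)

/-- The set of right children (positions ending with a right step). -/
def rightVertices (B : BT) : Finset (List Bool) :=
  B.paths.toFinset.filter (fun p => p.getLast? = some true)

end BT

/-- A non-ambiguous tree of shape `B`: bijective labellings of the left (resp. right)
children by `Fin |LV B|` (resp. `Fin |RV B|`), decreasing along ancestry. -/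
structure NAT (B : BT) where
  fL : {p // p ∈ B.leftVertices} → Fin B.leftVertices.card
  fR : {p // p ∈ B.rightVertices} → Fin B.rightVertices.card
  bijL : Function.Bijective fL
  bijR : Function.Bijective fR
  ancL : ∀ u v : {p // p ∈ B.leftVertices}, u.1 <+: v.1 → u ≠ v → (fL v : ℕ) < fL u
  ancR : ∀ u v : {p // p ∈ B.rightVertices}, u.1 <+: v.1 → u ≠ v → (fR v : ℕ) < fR u

namespace BT

/-- Length of the leftmost branch (left spine) of a binary tree, counting its root. -/
def leftChain : BT → ℕ
  | .nil => 0
  | .node l _ => l.leftChain + 1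

/-- Length of the rightmost branch (right spine) of a binary tree, counting its root. -/
def rightChain : BT → ℕ
  | .nil => 0
  | .node _ r => r.rightChain + 1

/-- `LO`: the number of left children on the leftmost branch of the root. -/
def lo : BT → ℕ
  | .nil => 0
  | .node l _ => l.leftChain

/-- `RO`: the number of right children on the rightmost branch of the root. -/
def ro : BT → ℕ
  | .nil => 0
  | .node _ r => r.rightChain

end BT

/-- The number of non-ambiguous trees (over all nonempty shapes) with `a` left children,
`b` right children, `LO = i` and `RO = j`. -/
noncomputable def natCountLR (a b i j : ℕ) : ℕ :=
  Nat.card {T : Σ B : BT, NAT B //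
    T.1 ≠ BT.nil ∧ T.1.leftVertices.card = a ∧ T.1.rightVertices.card = b ∧
      T.1.lo = i ∧ T.1.ro = j}

/-- The specialization of the `(α,β)`-generating series of non-ambiguous trees at
rational values `a`, `b`: `Σ_T a^{LO(T)} b^{RO(T)} x^{|LV T|} y^{|RV T|}/(|LV T|! |RV T|!)`. -/
noncomputable def natGFab (a b : ℚ) : MvPowerSeries (Fin 2) ℚ :=
  fun e =>
    (∑ i ∈ Finset.range (e 0 + 1), ∑ j ∈ Finset.range (e 1 + 1),
        (natCountLR (e 0) (e 1) i j : ℚ) * a ^ i * b ^ j) /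
      ((e 0).factorial * (e 1).factorial)

/-- The formal exponential series `e^{c₀ x + c₁ y} = Σ c₀^a c₁^b x^a y^b/(a! b!)`. -/
noncomputable def expXY (c₀ c₁ : ℚ) : MvPowerSeries (Fin 2) ℚ :=
  fun e => c₀ ^ (e 0) * c₁ ^ (e 1) / ((e 0).factorial * (e 1).factorial)


open MvPowerSeries

/-- Bijective labellings of `α` by `Fin n` that are strictly decreasing along `r`. -/
abbrev DecreasingLabeling {α : Type*} (r : α → α → Prop) (n : ℕ) : Type _ :=
  {f : α ≃ Fin n // ∀ u v, r u v → f v < f u}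

namespace DecreasingLabeling

theorem card_congr {α β : Type*} {r : α → α → Prop} {s : β → β → Prop} (e : α ≃ β)
    (h : ∀ u v, r u v ↔ s (e u) (e v)) (n : ℕ) :
    Nat.card (DecreasingLabeling r n) = Nat.card (DecreasingLabeling s n) := by
  refine Nat.card_congr ((e.equivCongr (Equiv.refl (Fin n))).subtypeEquiv fun f => ?_)
  refine ⟨fun hf u v huv => ?_, fun hf u v huv => ?_⟩
  · simpa using hf (e.symm u) (e.symm v) ((h _ _).2 (by simpa using huv))
  · simpa using hf (e u) (e v) ((h _ _).1 huv)

theorem card_option {α : Type*} {r : α → α → Prop} {s : Option α → Option α → Prop} (n : ℕ)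
    (hs : ∀ u v, s (some u) (some v) ↔ r u v) (htop : ∀ v, s none (some v))
    (hbot : ∀ u, ¬ s u none) :
    Nat.card (DecreasingLabeling s (n + 1)) = Nat.card (DecreasingLabeling r n) := by
  symm
  let φ : DecreasingLabeling r n → DecreasingLabeling s (n + 1) := fun f =>
    ⟨(Equiv.optionCongr f.1).trans finSuccEquivLast.symm, by
      rintro (_ | u) (_ | v) huv
      · exact absurd huv (hbot _)
      · simp [Fin.castSucc_lt_last]
      · exact absurd huv (hbot _)
      · simpa using f.2 u v ((hs u v).1 huv)⟩
  refine Nat.card_congr (Equiv.ofBijective φ ⟨fun f g hfg => ?_, fun f => ?_⟩)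
  · refine Subtype.ext (Equiv.ext fun u => ?_)
    have := DFunLike.congr_fun (congrArg Subtype.val hfg) (some u)
    simpa [φ] using this
  · have hnone : f.1 none = Fin.last n := by
      obtain ⟨u, hu⟩ := f.1.surjective (Fin.last n)
      cases u with
      | none => exact hu
      | some u =>
        have := f.2 _ _ (htop u)
        rw [hu] at this
        exact absurd this (Fin.le_last _).not_gt
    let g : Option α ≃ Option (Fin n) := f.1.trans finSuccEquivLast
    have hg : g none = none := by simp [g, hnone]
    have hsome : ∀ u, some (Equiv.removeNone g u) = g (some u) := fun u => by
      apply Equiv.removeNone_some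
      rw [← Option.ne_none_iff_exists']
      intro hu
      exact absurd (g.injective (hu.trans hg.symm)) (by simp)
    have hcast : ∀ u, (Equiv.removeNone g u).castSucc = f.1 (some u) := fun u => by
      rw [← finSuccEquivLast_symm_some, hsome]
      simp [g]
    refine ⟨⟨Equiv.removeNone g, fun u v huv => ?_⟩, Subtype.ext (Equiv.ext ?_)⟩
    · have := f.2 _ _ ((hs u v).2 huv)
      rwa [← hcast, ← hcast, Fin.castSucc_lt_castSucc_iff] at this
    · rintro (_ | u)
      · simp [φ, hnone]
      · simp [φ, hcast]

theorem card_sum {α β : Type*} [Fintype α] [Fintype β] {r : α → α → Prop} {s : β → β → Prop}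
    {m n : ℕ} (hα : Fintype.card α = m) (hβ : Fintype.card β = n) :
    Nat.card (DecreasingLabeling (Sum.LiftRel r s) (m + n)) =
      (m + n).choose m * (Nat.card (DecreasingLabeling r m) *
        Nat.card (DecreasingLabeling s n)) := by
  classical
  have hcompl : ∀ A : Finset (Fin (m + n)), A.card = m → Aᶜ.card = n := fun A hA => by
    rw [Finset.card_compl, Fintype.card_fin, hA, Nat.add_sub_cancel_left]
  have himage : ∀ f : α ⊕ β ≃ Fin (m + n),
      (Finset.univ.image fun x => f (Sum.inl x)).card = m := fun f =>
    (Finset.card_image_of_injective _ (f.injective.comp Sum.inl_injective)).trans hα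
  let φ : {A : Finset (Fin (m + n)) // A.card = m} ×
      DecreasingLabeling r m × DecreasingLabeling s n →
      DecreasingLabeling (Sum.LiftRel r s) (m + n) := fun t =>
    ⟨(Equiv.sumCongr t.2.1.1 t.2.2.1).trans
        (finSumEquivOfFinset t.1.2 (hcompl _ t.1.2)), by
      rintro _ _ (⟨h⟩ | ⟨h⟩)
      · simpa using t.2.1.2 _ _ h
      · simpa using t.2.2.2 _ _ h⟩
  have hφl : ∀ t x, (φ t).1 (Sum.inl x) = t.1.1.orderEmbOfFin t.1.2 (t.2.1.1 x) :=
    fun t x => by simp [φ]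
  have hφr : ∀ t x, (φ t).1 (Sum.inr x) =
      t.1.1ᶜ.orderEmbOfFin (hcompl _ t.1.2) (t.2.2.1 x) := fun t x => by simp [φ]
  have hφA : ∀ t, Finset.univ.image (fun x => (φ t).1 (Sum.inl x)) = t.1.1 := fun t => by
    refine Finset.eq_of_subset_of_card_le (fun i hi => ?_) ?_
    · obtain ⟨x, -, rfl⟩ := Finset.mem_image.1 hi
      rw [hφl]
      exact Finset.orderEmbOfFin_mem _ _ _
    · rw [himage, t.1.2]
  have hφ : Function.Bijective φ := by
    constructor
    · rintro t t' h
      have hA : t.1 = t'.1 := Subtype.ext (by rw [← hφA t, ← hφA t', h])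
      obtain ⟨A, g, k⟩ := t
      obtain ⟨A', g', k'⟩ := t'
      obtain rfl : A = A' := hA
      congr 2
      · refine Subtype.ext (Equiv.ext fun x => ?_)
        have h1 := hφl (A, g, k) x
        rw [h, hφl] at h1
        exact ((A.1.orderEmbOfFin A.2).injective h1).symm
      · refine Subtype.ext (Equiv.ext fun x => ?_)
        have h1 := hφr (A, g, k) x
        rw [h, hφr] at h1
        exact ((A.1ᶜ.orderEmbOfFin (hcompl _ A.2)).injective h1).symm
    · rintro ⟨f, hf⟩
      let A := Finset.univ.image fun x => f (Sum.inl x)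
      have hA : A.card = m := himage f
      have hl : ∀ x, f (Sum.inl x) ∈ A := fun x =>
        Finset.mem_image_of_mem _ (Finset.mem_univ x)
      have hr : ∀ x, f (Sum.inr x) ∈ Aᶜ := fun x => by simp [A]
      let g : α → Fin m := fun x => (A.orderIsoOfFin hA).symm ⟨_, hl x⟩
      let k : β → Fin n := fun x => (Aᶜ.orderIsoOfFin (hcompl A hA)).symm ⟨_, hr x⟩
      have hg : Function.Bijective g := by
        rw [Fintype.bijective_iff_injective_and_card]
        exact ⟨fun x y hxy => by simpa [g] using hxy, by simpa using hα⟩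
      have hk : Function.Bijective k := by
        rw [Fintype.bijective_iff_injective_and_card]
        exact ⟨fun x y hxy => by simpa [k] using hxy, by simpa using hβ⟩
      refine ⟨(⟨A, hA⟩, ⟨Equiv.ofBijective g hg, fun u v huv => ?_⟩,
        ⟨Equiv.ofBijective k hk, fun u v huv => ?_⟩), Subtype.ext (Equiv.ext ?_)⟩
      · simpa [g] using hf _ _ (Sum.LiftRel.inl huv)
      · simpa [k] using hf _ _ (Sum.LiftRel.inr huv)
      · rintro (x | x)
        · rw [hφl]
          simp [g, ← Finset.coe_orderIsoOfFin_apply]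
        · rw [hφr]
          simp [k, ← Finset.coe_orderIsoOfFin_apply]
  rw [← Nat.card_congr (Equiv.ofBijective φ hφ), Nat.card_prod, Nat.card_prod,
    Nat.card_eq_fintype_card, Fintype.card_finset_len, Fintype.card_fin]

end DecreasingLabeling

/-- Strict ancestry among the positions in `S`. -/
abbrev StrictAncestor (S : Finset (List Bool)) (u v : S) : Prop :=
  u.1 <+: v.1 ∧ u.1 ≠ v.1

/-- The proportion of bijective labellings of `S` that decrease along ancestry. -/
noncomputable def labelingWeight (S : Finset (List Bool)) : ℚ :=
  Nat.card (DecreasingLabeling (StrictAncestor S) S.card) / S.card.factorial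

theorem labelingWeight_empty : labelingWeight ∅ = 1 := by
  have : Nat.card (DecreasingLabeling (StrictAncestor ∅) (∅ : Finset (List Bool)).card) = 1 := by
    rw [Nat.card_eq_one_iff_unique]
    exact ⟨⟨fun f g => Subtype.ext (Equiv.ext fun u => absurd u.2 (Finset.notMem_empty _))⟩,
      ⟨⟨Finset.equivFin ∅, fun u => absurd u.2 (Finset.notMem_empty _)⟩⟩⟩
  rw [labelingWeight, this]
  simp

theorem labelingWeight_insert_nil {S : Finset (List Bool)} (hS : [] ∉ S) :
    labelingWeight (insert [] S) = labelingWeight S / (S.card + 1) := by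
  let φ : Option S → (insert [] S : Finset (List Bool)) := fun u =>
    u.elim ⟨[], Finset.mem_insert_self _ _⟩ fun p => ⟨p.1, Finset.mem_insert_of_mem p.2⟩
  have hφ : Function.Bijective φ := by
    constructor
    · rintro (_ | ⟨u, hu⟩) (_ | ⟨v, hv⟩) h
      · rfl
      · exact absurd (congrArg Subtype.val h) (fun h' =>
          hS (by rw [show [] = v from h']; exact hv))
      · exact absurd (congrArg Subtype.val h) (fun h' =>
          hS (by rw [← show u = [] from h']; exact hu))
      · simpa [φ] using h
    · rintro ⟨p, hp⟩
      rcases Finset.mem_insert.1 hp with rfl | hp'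
      · exact ⟨none, rfl⟩
      · exact ⟨some ⟨p, hp'⟩, rfl⟩
  have hcard := DecreasingLabeling.card_congr
    (r := fun u v => StrictAncestor _ (φ u) (φ v)) (s := StrictAncestor (insert [] S))
    (Equiv.ofBijective φ hφ) (fun _ _ => Iff.rfl) (S.card + 1)
  rw [DecreasingLabeling.card_option (r := StrictAncestor S)] at hcard
  · rw [labelingWeight, labelingWeight, Finset.card_insert_of_notMem hS, ← hcard,
      Nat.factorial_succ]
    push_cast
    rw [mul_comm, div_div]
  · intro u v
    simp [φ, StrictAncestor]
  · intro v
    simpa [φ, StrictAncestor] using fun h : [] = v.1 => hS (h ▸ v.2)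
  · rintro (_ | ⟨u, hu⟩)
    · simp [StrictAncestor]
    · simp [φ, StrictAncestor]

/-- The positions of a tree whose left and right subtrees have positions `S` and `T`. -/
def joinPositions (S T : Finset (List Bool)) : Finset (List Bool) :=
  S.image (List.cons false) ∪ T.image (List.cons true)

theorem card_joinPositions (S T : Finset (List Bool)) :
    (joinPositions S T).card = S.card + T.card := by
  rw [joinPositions, Finset.card_union_of_disjoint, Finset.card_image_of_injective,
    Finset.card_image_of_injective]
  · exact List.cons_injective
  · exact List.cons_injective
  · simp [Finset.disjoint_left]

theorem labelingWeight_joinPositions (S T : Finset (List Bool)) :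
    labelingWeight (joinPositions S T) = labelingWeight S * labelingWeight T := by
  let φ : S ⊕ T → joinPositions S T := Sum.elim
    (fun p => ⟨false :: p.1, Finset.mem_union_left _ (Finset.mem_image_of_mem _ p.2)⟩)
    (fun p => ⟨true :: p.1, Finset.mem_union_right _ (Finset.mem_image_of_mem _ p.2)⟩)
  have hφ : Function.Bijective φ := by
    constructor
    · rintro (⟨u, hu⟩ | ⟨u, hu⟩) (⟨v, hv⟩ | ⟨v, hv⟩) h <;>
        simpa [φ] using congrArg Subtype.val h
    · rintro ⟨p, hp⟩
      rcases Finset.mem_union.1 hp with hp' | hp'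
      · obtain ⟨q, hq, rfl⟩ := Finset.mem_image.1 hp'
        exact ⟨Sum.inl ⟨q, hq⟩, rfl⟩
      · obtain ⟨q, hq, rfl⟩ := Finset.mem_image.1 hp'
        exact ⟨Sum.inr ⟨q, hq⟩, rfl⟩
  have hcard := DecreasingLabeling.card_congr
    (r := Sum.LiftRel (StrictAncestor S) (StrictAncestor T))
    (s := StrictAncestor (joinPositions S T)) (Equiv.ofBijective φ hφ)
    (by rintro (⟨u, hu⟩ | ⟨u, hu⟩) (⟨v, hv⟩ | ⟨v, hv⟩) <;>
      simp [φ, StrictAncestor]) (S.card + T.card)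
  rw [DecreasingLabeling.card_sum (Fintype.card_coe S) (Fintype.card_coe T)] at hcard
  rw [labelingWeight, card_joinPositions, ← hcard, labelingWeight, labelingWeight]
  push_cast
  rw [Nat.cast_add_choose]
  have h := fun n : ℕ => (Nat.cast_ne_zero (R := ℚ)).2 n.factorial_ne_zero
  have h1 := h S.card
  have h2 := h T.card
  have h3 := h (S.card + T.card)
  field_simp

namespace BT

/-- The vertices that are left (`c = false`) or right (`c = true`) children. -/
def childVertices (c : Bool) (B : BT) : Finset (List Bool) :=
  B.paths.toFinset.filter (fun p => p.getLast? = some c)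

/-- The vertices of `B` that become left (`c = false`) or right (`c = true`) children once `B` is
hung as a left (`d = false`) or right (`d = true`) subtree. -/
def branchVertices (c d : Bool) (B : BT) : Finset (List Bool) :=
  B.paths.toFinset.filter (fun p => (d :: p).getLast? = some c)

theorem childVertices_node (c : Bool) (l r : BT) :
    childVertices c (node l r) =
      joinPositions (branchVertices c false l) (branchVertices c true r) := by
  ext p
  rcases p with _ | ⟨_ | _, p⟩ <;>
    simp [childVertices, branchVertices, joinPositions, paths]

theorem branchVertices_nil (c d : Bool) : branchVertices c d nil = ∅ := by
  simp [branchVertices, paths]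

theorem nil_notMem_childVertices (c : Bool) (B : BT) : [] ∉ childVertices c B := by
  simp [childVertices]

theorem branchVertices_of_ne {c d : Bool} (h : d ≠ c) (B : BT) :
    branchVertices c d B = childVertices c B := by
  ext p
  cases p with
  | nil => simp [branchVertices, childVertices, h]
  | cons x p => simp [branchVertices, childVertices]

theorem branchVertices_self_node (c : Bool) (l r : BT) :
    branchVertices c c (node l r) = insert [] (childVertices c (node l r)) := by
  ext p
  cases p with
  | nil => simp [branchVertices, paths]
  | cons x p => simp [branchVertices, childVertices]

theorem card_branchVertices_self_node (c : Bool) (l r : BT) :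
    (branchVertices c c (node l r)).card = (childVertices c (node l r)).card + 1 := by
  rw [branchVertices_self_node, Finset.card_insert_of_notMem (nil_notMem_childVertices _ _)]

/-- All binary trees of height at most `k`. -/
def ofHeightLE : ℕ → Finset BT
  | 0 => {nil}
  | k + 1 => insert nil ((ofHeightLE k ×ˢ ofHeightLE k).image fun t => node t.1 t.2)

theorem mem_ofHeightLE (d : Bool) {B : BT} {k : ℕ}
    (h : (branchVertices false d B).card + (branchVertices true d B).card ≤ k) :
    B ∈ ofHeightLE k := by
  induction B generalizing d k with
  | nil => cases k <;> simp [ofHeightLE]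
  | node l r ihl ihr =>
    have hcard : (branchVertices false d (node l r)).card +
        (branchVertices true d (node l r)).card =
        (childVertices false (node l r)).card + (childVertices true (node l r)).card + 1 := by
      cases d
      · rw [card_branchVertices_self_node, branchVertices_of_ne (by simp)]
        omega
      · rw [card_branchVertices_self_node, branchVertices_of_ne (by simp)]
        omega
    rw [hcard, childVertices_node, childVertices_node, card_joinPositions,
      card_joinPositions] at h
    obtain ⟨k, rfl⟩ : ∃ k', k = k' + 1 := ⟨k - 1, by omega⟩
    refine Finset.mem_insert_of_mem (Finset.mem_image.2
      ⟨(l, r), Finset.mem_product.2 ⟨?_, ?_⟩, rfl⟩)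
    · exact ihl false (by omega)
    · exact ihr true (by omega)

/-- The number of vertices on the leftmost (`d = false`) or rightmost (`d = true`) branch. -/
def chain (d : Bool) (B : BT) : ℕ :=
  bif d then B.rightChain else B.leftChain

theorem chain_le (d : Bool) (B : BT) : B.chain d ≤ (branchVertices d d B).card := by
  induction B with
  | nil => cases d <;> simp [chain, leftChain, rightChain]
  | node l r ihl ihr =>
    rw [card_branchVertices_self_node, childVertices_node, card_joinPositions]
    cases d
    · simp only [chain, cond_false, leftChain] at *
      omega
    · simp only [chain, cond_true, rightChain] at *
      omega

theorem lo_le (B : BT) : B.lo ≤ (childVertices false B).card := by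
  cases B with
  | nil => simp [lo]
  | node l r =>
    rw [childVertices_node, card_joinPositions]
    exact (chain_le false l).trans (Nat.le_add_right _ _)

theorem ro_le (B : BT) : B.ro ≤ (childVertices true B).card := by
  cases B with
  | nil => simp [ro]
  | node l r =>
    rw [childVertices_node, card_joinPositions]
    exact (chain_le true r).trans (Nat.le_add_left _ _)

end BT

/-- A non-ambiguous tree is a pair of decreasing labellings. -/
noncomputable def NAT.equivProd (B : BT) :
    NAT B ≃ DecreasingLabeling (StrictAncestor B.leftVertices) B.leftVertices.card ×
      DecreasingLabeling (StrictAncestor B.rightVertices) B.rightVertices.card where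
  toFun T := (⟨Equiv.ofBijective T.fL T.bijL,
      fun u v h => T.ancL u v h.1 fun h' => h.2 (congrArg _ h')⟩,
    ⟨Equiv.ofBijective T.fR T.bijR,
      fun u v h => T.ancR u v h.1 fun h' => h.2 (congrArg _ h')⟩)
  invFun f := ⟨f.1.1, f.2.1, f.1.1.bijective, f.2.1.bijective,
    fun u v h h' => f.1.2 u v ⟨h, fun e => h' (Subtype.ext e)⟩,
    fun u v h h' => f.2.2 u v ⟨h, fun e => h' (Subtype.ext e)⟩⟩
  left_inv _ := rfl
  right_inv _ := Prod.ext (Subtype.ext (Equiv.ext fun _ => rfl))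
    (Subtype.ext (Equiv.ext fun _ => rfl))

instance (B : BT) : Finite (NAT B) :=
  Finite.of_equiv _ (NAT.equivProd B).symm

theorem NAT.card_eq (B : BT) :
    (Nat.card (NAT B) : ℚ) = labelingWeight (B.childVertices false) *
      labelingWeight (B.childVertices true) *
      ((B.childVertices false).card.factorial * (B.childVertices true).card.factorial) := by
  have h := fun n : ℕ => (Nat.cast_ne_zero (R := ℚ)).2 n.factorial_ne_zero
  have h1 := h (B.childVertices false).card
  have h2 := h (B.childVertices true).card
  rw [Nat.card_congr (NAT.equivProd B), Nat.card_prod, labelingWeight, labelingWeight]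
  push_cast
  field_simp
  rfl

/-- The variable counting left (`d = false`) or right (`d = true`) children. -/
def childVar (d : Bool) : Fin 2 :=
  bif d then 1 else 0

/-- The exponent of the monomial `x ^ m * y ^ n`. -/
noncomputable def bidegree (m n : ℕ) : Fin 2 →₀ ℕ :=
  Finsupp.single 0 m + Finsupp.single 1 n

theorem bidegree_zero (m n : ℕ) : bidegree m n 0 = m := by simp [bidegree]

theorem bidegree_one (m n : ℕ) : bidegree m n 1 = n := by simp [bidegree]

theorem eq_bidegree_iff {e : Fin 2 →₀ ℕ} {m n : ℕ} :
    e = bidegree m n ↔ m = e 0 ∧ n = e 1 := by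
  rw [Finsupp.ext_iff, Fin.forall_fin_two, bidegree_zero, bidegree_one, eq_comm (a := m),
    eq_comm (a := n)]

theorem bidegree_add (m n m' n' : ℕ) :
    bidegree m n + bidegree m' n' = bidegree (m + m') (n + n') := by
  rw [eq_bidegree_iff]
  simp [bidegree_zero, bidegree_one]

theorem pderiv_monomial_add_single (i : Fin 2) (m : Fin 2 →₀ ℕ) (c : ℚ) :
    pderiv ℚ i (monomial (m + Finsupp.single i 1) (c / (m i + 1))) = monomial m c := by
  classical
  ext n
  rw [coeff_pderiv, coeff_monomial, coeff_monomial]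
  by_cases h : n = m
  · subst h
    have : (n i + 1 : ℚ) ≠ 0 := by positivity
    simp only [if_true]
    field_simp
  · rw [if_neg h, if_neg (fun h' => h (add_right_cancel h')), zero_mul]

/-- The term of a nonempty tree in the generating series. -/
noncomputable def treeTerm (B : BT) : MvPowerSeries (Fin 2) ℚ :=
  monomial (bidegree (B.childVertices false).card (B.childVertices true).card)
    (labelingWeight (B.childVertices false) * labelingWeight (B.childVertices true))

/-- The contribution of `B` when hung as a left (`d = false`) or right (`d = true`) subtree. -/
noncomputable def branchTerm (d : Bool) (B : BT) : MvPowerSeries (Fin 2) ℚ :=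
  monomial (bidegree (B.branchVertices false d).card (B.branchVertices true d).card)
    (labelingWeight (B.branchVertices false d) * labelingWeight (B.branchVertices true d))

theorem treeTerm_node (l r : BT) :
    treeTerm (.node l r) = branchTerm false l * branchTerm true r := by
  simp only [treeTerm, branchTerm, BT.childVertices_node, labelingWeight_joinPositions,
    card_joinPositions, monomial_mul_monomial, bidegree_add]
  congr 1
  ring

theorem branchTerm_nil (d : Bool) : branchTerm d .nil = 1 := by
  simp [branchTerm, BT.branchVertices_nil, labelingWeight_empty, bidegree, monomial_zero_one]

theorem pderiv_branchTerm_node (d : Bool) (l r : BT) :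
    pderiv ℚ (childVar d) (branchTerm d (.node l r)) = treeTerm (.node l r) := by
  have hdeg : bidegree ((BT.node l r).branchVertices false d).card
      ((BT.node l r).branchVertices true d).card =
      bidegree ((BT.node l r).childVertices false).card ((BT.node l r).childVertices true).card +
        Finsupp.single (childVar d) 1 := by
    symm
    rw [eq_bidegree_iff]
    cases d <;>
      simp [BT.card_branchVertices_self_node, BT.branchVertices_of_ne, childVar, bidegree_zero,
        bidegree_one]
  rw [treeTerm, ← pderiv_monomial_add_single (childVar d), branchTerm, hdeg]
  congr 2
  cases d
  · rw [BT.branchVertices_self_node, BT.branchVertices_of_ne (by simp),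
      labelingWeight_insert_nil (BT.nil_notMem_childVertices _ _)]
    simp only [childVar, cond_false, bidegree_zero]
    ring
  · rw [BT.branchVertices_self_node, BT.branchVertices_of_ne (by simp),
      labelingWeight_insert_nil (BT.nil_notMem_childVertices _ _)]
    simp only [childVar, cond_true, bidegree_one]
    ring

namespace BT

theorem sum_ofHeightLE_succ {M : Type*} [AddCommMonoid M] (f : BT → M) (k : ℕ) :
    ∑ B ∈ ofHeightLE (k + 1), f B =
      f nil + ∑ l ∈ ofHeightLE k, ∑ r ∈ ofHeightLE k, f (node l r) := by
  rw [ofHeightLE, Finset.sum_insert (by simp), Finset.sum_image, Finset.sum_product]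
  rintro ⟨l, r⟩ - ⟨l', r'⟩ - h
  simpa using h

theorem nil_mem_ofHeightLE (k : ℕ) : nil ∈ ofHeightLE k := by
  cases k <;> simp [ofHeightLE]

end BT

/-- The generating series of left (`d = false`) or right (`d = true`) subtrees of height at most
`k`, where `a` marks the length of the outer branch. -/
noncomputable def branchSeries (d : Bool) (a : ℚ) (k : ℕ) : MvPowerSeries (Fin 2) ℚ :=
  ∑ B ∈ BT.ofHeightLE k, a ^ B.chain d • branchTerm d B

theorem pderiv_branchSeries_succ (d : Bool) (a : ℚ) (k : ℕ) :
    pderiv ℚ (childVar d) (branchSeries d a (k + 1)) =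
      a • (branchSeries d a k * branchSeries (!d) 1 k) := by
  rw [branchSeries, map_sum, BT.sum_ofHeightLE_succ]
  simp only [Derivation.map_smul, pderiv_branchTerm_node, treeTerm_node, branchTerm_nil,
    Derivation.map_one_eq_zero, smul_zero, zero_add]
  cases d
  · simp only [branchSeries, Finset.sum_mul_sum, Finset.smul_sum, Bool.not_false, one_pow,
      one_smul, BT.chain, cond_false, BT.leftChain]
    refine Finset.sum_congr rfl fun l _ => Finset.sum_congr rfl fun r _ => ?_
    rw [smul_mul_assoc, smul_smul, pow_succ']
  · rw [Finset.sum_comm]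
    simp only [branchSeries, Finset.sum_mul_sum, Finset.smul_sum, Bool.not_true, one_pow,
      one_smul, BT.chain, cond_true, BT.rightChain]
    refine Finset.sum_congr rfl fun l _ => Finset.sum_congr rfl fun r _ => ?_
    rw [smul_mul_assoc, smul_smul, pow_succ', mul_comm (branchTerm false r)]

theorem coeff_branchSeries_of_eq_zero {d : Bool} {e : Fin 2 →₀ ℕ} (he : e (childVar d) = 0)
    (a : ℚ) (k : ℕ) : coeff e (branchSeries d a k) = coeff e 1 := by
  classical
  rw [branchSeries, map_sum, Finset.sum_eq_single BT.nil]
  · have : BT.nil.chain d = 0 := by cases d <;> rfl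
    rw [branchTerm_nil, this, pow_zero, one_smul]
  · rintro (_ | ⟨l, r⟩) - hB
    · exact absurd rfl hB
    · rw [map_smul, branchTerm, coeff_monomial, if_neg, smul_zero]
      rw [eq_bidegree_iff]
      rintro ⟨h0, h1⟩
      have := BT.card_branchVertices_self_node d l r
      cases d
      · exact absurd (this.symm.trans (h0.trans he)) (Nat.succ_ne_zero _)
      · exact absurd (this.symm.trans (h1.trans he)) (Nat.succ_ne_zero _)
  · exact fun h => absurd (BT.nil_mem_ofHeightLE k) h

theorem pderiv_zero_expXY (c₀ c₁ : ℚ) : pderiv ℚ 0 (expXY c₀ c₁) = c₀ • expXY c₀ c₁ := by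
  ext e
  rw [coeff_pderiv, map_smul]
  change c₀ ^ ((e + Finsupp.single 0 1 : Fin 2 →₀ ℕ) 0) *
    c₁ ^ ((e + Finsupp.single 0 1 : Fin 2 →₀ ℕ) 1) / _ * _ =
    c₀ * (c₀ ^ (e 0) * c₁ ^ (e 1) / ((e 0).factorial * (e 1).factorial))
  simp [Nat.factorial_succ, pow_succ]
  field_simp

theorem pderiv_one_expXY (c₀ c₁ : ℚ) : pderiv ℚ 1 (expXY c₀ c₁) = c₁ • expXY c₀ c₁ := by
  ext e
  rw [coeff_pderiv, map_smul]
  change c₀ ^ ((e + Finsupp.single 1 1 : Fin 2 →₀ ℕ) 0) *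
    c₁ ^ ((e + Finsupp.single 1 1 : Fin 2 →₀ ℕ) 1) / _ * _ =
    c₁ * (c₀ ^ (e 0) * c₁ ^ (e 1) / ((e 0).factorial * (e 1).factorial))
  simp [Nat.factorial_succ, pow_succ]
  field_simp

theorem constantCoeff_expXY (c₀ c₁ : ℚ) : constantCoeff (expXY c₀ c₁) = 1 := by
  change c₀ ^ 0 * c₁ ^ 0 / (Nat.factorial 0 * Nat.factorial 0) = (1 : ℚ)
  simp

theorem pderiv_pow_of_eigenvector {i : Fin 2} {f : MvPowerSeries (Fin 2) ℚ} {c : ℚ}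
    (hf : pderiv ℚ i f = c • f) (n : ℕ) : pderiv ℚ i (f ^ n) = (n * c) • f ^ n := by
  rw [pderiv_pow, hf]
  cases n with
  | zero => simp
  | succ n =>
    rw [Nat.add_sub_cancel, smul_eq_C_mul, smul_eq_C_mul, map_mul, map_natCast]
    ring

theorem mul_expXY_neg_eq_one {f : MvPowerSeries (Fin 2) ℚ} {a b : ℚ}
    (h0 : pderiv ℚ 0 f = a • f) (h1 : pderiv ℚ 1 f = b • f) (hc : constantCoeff f = 1) :
    f * expXY (-a) (-b) = 1 := by
  refine pderiv.ext (fun i => ?_) (by simp [constantCoeff_expXY, hc])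
  fin_cases i
  · simp [h0, pderiv_zero_expXY, mul_comm]
  · simp [h1, pderiv_one_expXY, mul_comm]

theorem expXY_pow_mul_pow (a b : ℕ) :
    expXY 1 0 ^ a * expXY 0 1 ^ b = expXY a b := by
  have h : expXY a b * expXY (-a) (-b) = 1 :=
    mul_expXY_neg_eq_one (pderiv_zero_expXY _ _) (pderiv_one_expXY _ _) (constantCoeff_expXY _ _)
  refine mul_right_cancel₀ (right_ne_zero_of_mul_eq_one h) (Eq.trans ?_ h.symm)
  apply mul_expXY_neg_eq_one
  · simp [pderiv_pow_of_eigenvector (pderiv_zero_expXY _ _), mul_comm]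
  · simp [pderiv_pow_of_eigenvector (pderiv_one_expXY _ _)]
  · simp [constantCoeff_expXY]

/-- The exponential series in a single variable. -/
noncomputable def expVar (d : Bool) : MvPowerSeries (Fin 2) ℚ :=
  bif d then expXY 0 1 else expXY 1 0

/-- The common denominator `1 - (eˣ - 1) * (e^y - 1)`. -/
noncomputable def expDenom : MvPowerSeries (Fin 2) ℚ :=
  1 - (expXY 1 0 - 1) * (expXY 0 1 - 1)

theorem constantCoeff_expDenom : constantCoeff expDenom = 1 := by
  simp [expDenom, constantCoeff_expXY]

theorem expDenom_mul_inv : expDenom * expDenom⁻¹ = 1 :=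
  MvPowerSeries.mul_inv_cancel _ (by simp [constantCoeff_expDenom])

/-- The limit of `branchSeries d 1 k` for `k` going to infinity. -/
noncomputable def branchLimit (d : Bool) : MvPowerSeries (Fin 2) ℚ :=
  expVar d * expDenom⁻¹

theorem pderiv_branchLimit (d : Bool) :
    pderiv ℚ (childVar d) (branchLimit d) = branchLimit d * branchLimit (!d) := by
  have h := expDenom_mul_inv
  cases d
  · have hD : pderiv ℚ 0 expDenom = -(expXY 1 0 * (expXY 0 1 - 1)) := by
      simp [expDenom, pderiv_zero_expXY, mul_comm]
    simp only [branchLimit, expVar, childVar, cond_false, cond_true, Bool.not_false,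
      Derivation.leibniz, pderiv_inv', hD, pderiv_zero_expXY, smul_eq_mul, one_smul]
    nth_rw 1 [expDenom] at h
    linear_combination -(expXY 1 0 * expDenom⁻¹) * h
  · have hD : pderiv ℚ 1 expDenom = -(expXY 0 1 * (expXY 1 0 - 1)) := by
      simp [expDenom, pderiv_one_expXY, mul_comm]
    simp only [branchLimit, expVar, childVar, cond_false, cond_true, Bool.not_true,
      Derivation.leibniz, pderiv_inv', hD, pderiv_one_expXY, smul_eq_mul, one_smul]
    nth_rw 1 [expDenom] at h
    linear_combination -(expXY 0 1 * expDenom⁻¹) * h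

theorem X_dvd_expVar_sub_one (d : Bool) : X (childVar d) ∣ expVar d - 1 := by
  classical
  rw [X_dvd_iff]
  intro e he
  rw [map_sub, coeff_one, sub_eq_zero]
  have hzero : e = 0 ↔ e 0 = 0 ∧ e 1 = 0 := by
    rw [Finsupp.ext_iff, Fin.forall_fin_two]
    rfl
  cases d
  · change (1 : ℚ) ^ (e 0) * 0 ^ (e 1) / ((e 0).factorial * (e 1).factorial) = _
    change e 0 = 0 at he
    by_cases h1 : e 1 = 0 <;> simp [hzero, he, h1]
  · change (0 : ℚ) ^ (e 0) * 1 ^ (e 1) / ((e 0).factorial * (e 1).factorial) = _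
    change e 1 = 0 at he
    by_cases h1 : e 0 = 0 <;> simp [hzero, he, h1]

theorem X_dvd_branchLimit_sub_one (d : Bool) : X (childVar d) ∣ branchLimit d - 1 := by
  have h := expDenom_mul_inv
  nth_rw 1 [expDenom] at h
  have hfactor : branchLimit d - 1 = (expVar d - 1) * (expVar (!d) * expDenom⁻¹) := by
    cases d
    · simp only [branchLimit, expVar, cond_false, cond_true, Bool.not_false]
      linear_combination h
    · simp only [branchLimit, expVar, cond_false, cond_true, Bool.not_true]
      linear_combination h
  rw [hfactor]
  exact (X_dvd_expVar_sub_one d).mul_right _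

theorem coeff_branchLimit_pow_of_eq_zero {d : Bool} {e : Fin 2 →₀ ℕ}
    (he : e (childVar d) = 0) (a : ℕ) : coeff e (branchLimit d ^ a) = coeff e 1 := by
  have h : X (childVar d) ∣ branchLimit d ^ a - 1 :=
    (X_dvd_branchLimit_sub_one d).trans (by simpa using sub_dvd_pow_sub_pow (branchLimit d) 1 a)
  have := X_dvd_iff.1 h e he
  rwa [map_sub, sub_eq_zero] at this

theorem coeff_mul_congr_of_degree_lt {f f' g g' : MvPowerSeries (Fin 2) ℚ} {k : ℕ}
    (hf : ∀ e : Fin 2 →₀ ℕ, e.degree < k → coeff e f = coeff e f')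
    (hg : ∀ e : Fin 2 →₀ ℕ, e.degree < k → coeff e g = coeff e g')
    (e : Fin 2 →₀ ℕ) (he : e.degree < k) : coeff e (f * g) = coeff e (f' * g') := by
  classical
  rw [coeff_mul, coeff_mul]
  refine Finset.sum_congr rfl fun p hp => ?_
  rw [← Finset.HasAntidiagonal.mem_antidiagonal.1 hp, map_add] at he
  rw [hf _ (by omega), hg _ (by omega)]

theorem coeff_branchSeries (d : Bool) (a k : ℕ) (e : Fin 2 →₀ ℕ) (he : e.degree < k) :
    coeff e (branchSeries d a k) = coeff e (branchLimit d ^ a) := by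
  induction k generalizing d a e with
  | zero => exact absurd he (Nat.not_lt_zero _)
  | succ k ih =>
    by_cases h0 : e (childVar d) = 0
    · rw [coeff_branchSeries_of_eq_zero h0, coeff_branchLimit_pow_of_eq_zero h0]
    · obtain ⟨e, rfl⟩ : ∃ e', e = e' + Finsupp.single (childVar d) 1 := by
        refine ⟨e - Finsupp.single (childVar d) 1, (tsub_add_cancel_of_le ?_).symm⟩
        exact Finsupp.single_le_iff.2 (Nat.one_le_iff_ne_zero.2 h0)
      have hlt : e.degree < k := by
        rw [map_add, Finsupp.degree_single] at he
        omega
      have hpd : pderiv ℚ (childVar d) (branchLimit d ^ a) =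
          (a : ℚ) • (branchLimit d ^ a * branchLimit (!d) ^ 1) := by
        rw [pderiv_pow, pderiv_branchLimit]
        cases a with
        | zero => simp
        | succ a =>
          rw [Nat.add_sub_cancel, pow_one, smul_eq_C_mul, map_natCast]
          ring
      have hmul := coeff_mul_congr_of_degree_lt (fun e he => ih d a e he)
        (fun e he => ih (!d) 1 e he) e hlt
      have hne : (e (childVar d) + 1 : ℚ) ≠ 0 := by positivity
      refine mul_right_cancel₀ hne ?_
      rw [← coeff_pderiv, ← coeff_pderiv, pderiv_branchSeries_succ, hpd, map_smul, map_smul,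
        ← hmul, Nat.cast_one]

theorem BT.mem_ofHeightLE_of_card_childVertices_lt (B : BT) {k : ℕ}
    (h : (B.childVertices false).card + (B.childVertices true).card < k) :
    B ∈ BT.ofHeightLE k := by
  cases B with
  | nil => exact BT.nil_mem_ofHeightLE k
  | node l r =>
    refine BT.mem_ofHeightLE false ?_
    rw [BT.card_branchVertices_self_node, BT.branchVertices_of_ne (by simp)]
    omega

theorem natCountLR_eq_sum {m n k : ℕ} (hk : m + n < k) (i j : ℕ) :
    natCountLR m n i j =
      ∑ B ∈ BT.ofHeightLE k with B ≠ .nil ∧ (B.childVertices false).card = m ∧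
        (B.childVertices true).card = n,
        if B.lo = i ∧ B.ro = j then Nat.card (NAT B) else 0 := by
  classical
  let P : BT → Prop := fun B => B ≠ .nil ∧ B.leftVertices.card = m ∧ B.rightVertices.card = n ∧
    B.lo = i ∧ B.ro = j
  let F := (BT.ofHeightLE k).filter P
  have hF : ∀ B, B ∈ F ↔ P B := fun B => by
    refine Finset.mem_filter.trans (and_iff_right_of_imp fun h => ?_)
    exact BT.mem_ofHeightLE_of_card_childVertices_lt B (h.2.1 ▸ h.2.2.1 ▸ hk)
  let _ : Fintype (Subtype P) := Fintype.subtype F hF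
  rw [natCountLR, Nat.card_congr (Equiv.subtypeSigmaEquiv (fun B => NAT B) P), Nat.card_sigma,
    ← Finset.sum_filter, Finset.filter_filter,
    ← Finset.sum_subtype F hF (fun B => Nat.card (NAT B))]
  refine Finset.sum_congr (Finset.filter_congr fun B _ => ?_) fun _ _ => rfl
  simp only [P, and_assoc]
  rfl

theorem coeff_treeTerm (B : BT) (e : Fin 2 →₀ ℕ) :
    coeff e (treeTerm B) =
      if (B.childVertices false).card = e 0 ∧ (B.childVertices true).card = e 1 then
        (Nat.card (NAT B) : ℚ) / ((e 0).factorial * (e 1).factorial) else 0 := by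
  classical
  rw [treeTerm, coeff_monomial]
  simp only [eq_bidegree_iff]
  split_ifs with h
  · have h0 := fun n : ℕ => (Nat.cast_ne_zero (R := ℚ)).2 n.factorial_ne_zero
    have h1 := h0 (e 0)
    have h2 := h0 (e 1)
    rw [NAT.card_eq, h.1, h.2]
    field_simp
  · rfl

theorem coeff_natGFab (a b : ℚ) (e : Fin 2 →₀ ℕ) {k : ℕ} (hk : e.degree < k) :
    coeff e (natGFab a b) =
      ∑ B ∈ BT.ofHeightLE k with B ≠ .nil, a ^ B.lo * b ^ B.ro * coeff e (treeTerm B) := by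
  have hdeg : e 0 + e 1 < k := by
    rwa [Finsupp.degree_eq_sum, Fin.sum_univ_two] at hk
  change (∑ i ∈ Finset.range (e 0 + 1), ∑ j ∈ Finset.range (e 1 + 1),
    (natCountLR (e 0) (e 1) i j : ℚ) * a ^ i * b ^ j) /
      ((e 0).factorial * (e 1).factorial) = _
  simp only [natCountLR_eq_sum hdeg, coeff_treeTerm, mul_ite, mul_zero, Nat.cast_sum,
    Finset.sum_mul]
  rw [← Finset.sum_filter, Finset.filter_filter,
    Finset.sum_congr rfl fun i _ => Finset.sum_comm, Finset.sum_comm, Finset.sum_div]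
  refine Finset.sum_congr rfl fun B hB => ?_
  obtain ⟨-, -, h0, h1⟩ := Finset.mem_filter.1 hB
  have hlo : B.lo ∈ Finset.range (e 0 + 1) :=
    Finset.mem_range.2 (Nat.lt_succ_of_le (h0 ▸ B.lo_le))
  have hro : B.ro ∈ Finset.range (e 1 + 1) :=
    Finset.mem_range.2 (Nat.lt_succ_of_le (h1 ▸ B.ro_le))
  rw [Finset.sum_eq_single_of_mem _ hlo, Finset.sum_eq_single_of_mem _ hro]
  · rw [if_pos ⟨rfl, rfl⟩]
    ring
  · intro j _ hj
    rw [if_neg fun h => hj h.2.symm]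
    simp
  · intro i _ hi
    refine Finset.sum_eq_zero fun j _ => ?_
    rw [if_neg fun h => hi h.1.symm]
    simp

theorem natGFab_eq_branchLimit (a b : ℕ) :
    natGFab a b = branchLimit false ^ a * branchLimit true ^ b := by
  ext e
  have hlt : e.degree < e.degree + 1 := Nat.lt_succ_self _
  rw [← coeff_mul_congr_of_degree_lt (fun e he => coeff_branchSeries false a _ e he)
    (fun e he => coeff_branchSeries true b _ e he) e hlt,
    coeff_natGFab _ _ _ (hlt.trans (Nat.lt_succ_self _)), Finset.sum_filter,
    BT.sum_ofHeightLE_succ, if_neg (by simp), zero_add, branchSeries, branchSeries,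
    Finset.sum_mul_sum, map_sum]
  refine Finset.sum_congr rfl fun l _ => ?_
  rw [map_sum]
  refine Finset.sum_congr rfl fun r _ => ?_
  rw [if_pos (by simp), treeTerm_node, smul_mul_smul_comm, map_smul]
  rfl

/-- For natural numbers `a`, `b`:
`G^{(a,b)} · (1 − (eˣ−1)(e^y−1))^{a+b} = e^{ax+by}`. -/
theorem natGFab_closed_form (a b : ℕ) :
    natGFab a b * (1 - (expXY 1 0 - 1) * (expXY 0 1 - 1)) ^ (a + b) = expXY a b := by
  change natGFab a b * expDenom ^ (a + b) = _
  calc natGFab a b * expDenom ^ (a + b)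
      = expXY 1 0 ^ a * expXY 0 1 ^ b * (expDenom * expDenom⁻¹) ^ (a + b) := by
        rw [natGFab_eq_branchLimit]
        simp only [branchLimit, expVar, cond_false, cond_true]
        ring
    _ = expXY a b := by rw [expDenom_mul_inv, one_pow, mul_one, expXY_pow_mul_pow]
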